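/- Let v be a point of the box that is not a corner. Let J(v) = {i : 2a_i ∣ 2v_i}, and let A(v) be the set of all functions g : {1,…,n} → {0,1} such that for all i ≠ j, gcd(2a_i, 2a_j) divides (−1)^{g(i)} v_i − (−1)^{g(j)} v_j. Then 2^{|J(v)|+1} · M(v) = |A(v)|. -/

import Mathlib

/-- The crossing number of a point `v` of the discretized billiard box. -/
noncomputable def crossingNumber (n : ℕ) (a v : Fin n → ℤ) : ℕ :=
  Nat.card {x : ℤ // 0 ≤ x ∧ x ≤ Finset.univ.lcm a ∧
    ∀ i : Fin n, 2 * a i ∣ x - v i ∨ 2 * a i ∣ x + v i}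

/-- In `ℤ`, `gcd` distributes over `lcm`, stated as a divisibility criterion. -/
theorem gcd_lcm_dvd_of_gcd_dvd {a b c y : ℤ} (ha : gcd a c ∣ y) (hb : gcd b c ∣ y) :
    gcd (lcm a b) c ∣ y := by
  rcases eq_or_ne (gcd a b) 0 with h0 | h0
  · obtain ⟨rfl, rfl⟩ := (gcd_eq_zero_iff a b).1 h0
    simpa using ha
  obtain ⟨u, w, huw⟩ := (gcd_dvd_iff_exists a b).1 dvd_rfl
  obtain ⟨A, hA⟩ := gcd_dvd_left a b
  obtain ⟨B, hB⟩ := gcd_dvd_right a b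
  obtain ⟨s, t, hst⟩ := (gcd_dvd_iff_exists a c).1 ha
  obtain ⟨p, q, hpq⟩ := (gcd_dvd_iff_exists b c).1 hb
  have hbez : 1 = A * u + B * w := by
    apply mul_left_cancel₀ h0
    linear_combination huw + u * hA + w * hB
  have hl : lcm a b ∣ a * B := by
    refine lcm_dvd (dvd_mul_right a B) ⟨A, ?_⟩
    linear_combination B * hA - A * hB
  have hAB : a * B = b * A := by linear_combination B * hA - A * hB
  have hy : y = a * B * (p * u + s * w) + c * (q * A * u + t * B * w) := by
    linear_combination y * hbez + A * u * hpq + B * w * hst - p * u * hAB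
  rw [hy]
  exact dvd_add (((gcd_dvd_left _ _).trans hl).mul_right _) ((gcd_dvd_right _ _).mul_right _)

theorem gcd_finsetLcm_dvd_of_gcd_dvd {ι : Type*} (s : Finset ι) (m : ι → ℤ) {c y : ℤ}
    (h : ∀ i ∈ s, gcd (m i) c ∣ y) : gcd (s.lcm m) c ∣ y := by
  classical
  induction s using Finset.induction_on with
  | empty => simp
  | insert i s _ ih =>
    rw [Finset.lcm_insert]
    exact gcd_lcm_dvd_of_gcd_dvd (h i (Finset.mem_insert_self i s))
      (ih fun j hj => h j (Finset.mem_insert_of_mem hj))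

/-- The Chinese remainder theorem for moduli that need not be coprime. -/
theorem exists_forall_dvd_sub_of_gcd_dvd {ι : Type*} (s : Finset ι) (m c : ι → ℤ)
    (h : ∀ i ∈ s, ∀ j ∈ s, i ≠ j → gcd (m i) (m j) ∣ c i - c j) :
    ∃ x, ∀ i ∈ s, m i ∣ x - c i := by
  classical
  induction s using Finset.induction_on with
  | empty => simp
  | insert j s hj ih =>
    obtain ⟨x, hx⟩ := ih fun i hi k hk =>
      h i (Finset.mem_insert_of_mem hi) k (Finset.mem_insert_of_mem hk)
    have hgcd : gcd (s.lcm m) (m j) ∣ x - c j := by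
      refine gcd_finsetLcm_dvd_of_gcd_dvd s m fun i hi => ?_
      have hij := h i (Finset.mem_insert_of_mem hi) j (Finset.mem_insert_self j s)
        (ne_of_mem_of_not_mem hi hj)
      simpa using dvd_add ((gcd_dvd_left _ _).trans (hx i hi)) hij
    obtain ⟨p, q, hpq⟩ := (gcd_dvd_iff_exists _ _).1 hgcd
    refine ⟨x - s.lcm m * p, fun i hi => ?_⟩
    rcases Finset.mem_insert.1 hi with rfl | hi
    · exact ⟨q, by linear_combination hpq⟩
    · rw [sub_right_comm]
      exact dvd_sub (hx i hi) ((Finset.dvd_lcm hi).mul_right p)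

/-- Among the two signs of `w`, both are congruent to `x` modulo `m` when `m ∣ 2 * w`, and exactly
one otherwise, as soon as at least one is. -/
theorem card_filter_dvd_sub_sign_mul {m x w : ℤ} (h : m ∣ x - w ∨ m ∣ x + w) :
    (Finset.univ.filter fun b : Fin 2 => m ∣ x - (-1) ^ (b : ℕ) * w).card =
      if m ∣ 2 * w then 2 else 1 := by
  have hsum : m ∣ x - w → m ∣ x + w → m ∣ 2 * w := fun h₁ h₂ => by
    rw [show 2 * w = x + w - (x - w) by ring]; exact dvd_sub h₂ h₁
  have hadd : m ∣ x - w → m ∣ 2 * w → m ∣ x + w := fun h₁ h₂ => by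
    rw [show x + w = x - w + 2 * w by ring]; exact dvd_add h₁ h₂
  have hsub : m ∣ x + w → m ∣ 2 * w → m ∣ x - w := fun h₁ h₂ => by
    rw [show x - w = x + w - 2 * w by ring]; exact dvd_sub h₁ h₂
  rw [Finset.card_filter, Fin.sum_univ_two]
  simp only [Fin.val_zero, Fin.val_one, pow_zero, pow_one, one_mul, neg_mul, sub_neg_eq_add]
  split_ifs <;> tauto

/-- The number of sign choices for which `x` is congruent to the signed vector `v`. -/
theorem card_filter_forall_dvd_sub_sign_mul {ι : Type*} [Fintype ι] [DecidableEq ι]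
    {m v : ι → ℤ} {x : ℤ} (h : ∀ i, m i ∣ x - v i ∨ m i ∣ x + v i) :
    (Finset.univ.filter fun g : ι → Fin 2 => ∀ i, m i ∣ x - (-1) ^ (g i : ℕ) * v i).card =
      2 ^ (Finset.univ.filter fun i => m i ∣ 2 * v i).card := by
  have hpi : (Finset.univ.filter fun g : ι → Fin 2 => ∀ i, m i ∣ x - (-1) ^ (g i : ℕ) * v i) =
      Fintype.piFinset fun i =>
        Finset.univ.filter fun b : Fin 2 => m i ∣ x - (-1) ^ (b : ℕ) * v i := by
    ext g
    simp
  rw [hpi, Fintype.card_piFinset,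
    Finset.prod_congr rfl fun i _ => card_filter_dvd_sub_sign_mul (h i), Finset.prod_ite]
  simp

/-- A system of congruences with pairwise compatible residues has exactly one solution in a period
`[0, L)`, where `L` generates the common multiples of the moduli. -/
theorem card_filter_Ico_forall_dvd_sub {ι : Type*} [Fintype ι] {m c : ι → ℤ} {L : ℤ} (hL : 0 < L)
    (hm : ∀ y, L ∣ y ↔ ∀ i, m i ∣ y) (h : ∀ i j, i ≠ j → gcd (m i) (m j) ∣ c i - c j) :
    ((Finset.Ico 0 L).filter fun x => ∀ i, m i ∣ x - c i).card = 1 := by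
  obtain ⟨x, hx⟩ := exists_forall_dvd_sub_of_gcd_dvd Finset.univ m c fun i _ j _ => h i j
  refine Finset.card_eq_one.2 ⟨x % L, ?_⟩
  ext y
  simp only [Finset.mem_filter, Finset.mem_Ico, Finset.mem_singleton]
  constructor
  · rintro ⟨⟨hy₀, hyL⟩, hy⟩
    have hdvd : L ∣ x - y := (hm _).2 fun i => by
      simpa using dvd_sub (hx i (Finset.mem_univ i)) (hy i)
    rw [← Int.emod_eq_of_lt hy₀ hyL]
    exact Int.modEq_iff_dvd.2 hdvd
  · rintro rfl
    refine ⟨⟨Int.emod_nonneg x hL.ne', Int.emod_lt_of_pos x hL⟩, fun i => ?_⟩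
    have hdvd : m i ∣ x - x % L := (hm _).1 (Int.dvd_self_sub_emod) i
    simpa using dvd_sub (hx i (Finset.mem_univ i)) hdvd

/-- Reflection `x ↦ 2 * l - x` pairs up the elements of `[0, 2 * l)` on either side of `l`. -/
theorem card_filter_Ico_two_mul {l : ℤ} {P : ℤ → Prop} [DecidablePred P] (h₀ : ¬ P 0) (hl : ¬ P l)
    (hP : ∀ x, P (2 * l - x) ↔ P x) :
    ((Finset.Ico 0 (2 * l)).filter P).card = 2 * ((Finset.Icc 0 l).filter P).card := by
  have hsplit : (Finset.Ico 0 (2 * l)).filter P =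
      (Finset.Icc 0 l).filter P ∪ ((Finset.Icc 0 l).filter P).image (2 * l - ·) := by
    ext x
    simp only [Finset.mem_filter, Finset.mem_Ico, Finset.mem_union, Finset.mem_image,
      Finset.mem_Icc]
    constructor
    · rintro ⟨⟨hx₀, hx⟩, hPx⟩
      rcases le_or_gt x l with hxl | hxl
      · exact Or.inl ⟨⟨hx₀, hxl⟩, hPx⟩
      · exact Or.inr ⟨2 * l - x, ⟨⟨by lia, by lia⟩, (hP x).2 hPx⟩, by lia⟩
    · rintro (⟨⟨hx₀, hx⟩, hPx⟩ | ⟨y, ⟨⟨hy₀, hy⟩, hPy⟩, rfl⟩)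
      · have : x ≠ l := by rintro rfl; exact hl hPx
        exact ⟨⟨hx₀, by lia⟩, hPx⟩
      · have : y ≠ 0 := by rintro rfl; exact h₀ hPy
        exact ⟨⟨by lia, by lia⟩, (hP y).2 hPy⟩
  have hdisj : Disjoint ((Finset.Icc 0 l).filter P)
      (((Finset.Icc 0 l).filter P).image (2 * l - ·)) := by
    rw [Finset.disjoint_left]
    simp only [Finset.mem_filter, Finset.mem_image, Finset.mem_Icc]
    rintro x ⟨⟨_, hx⟩, hPx⟩ ⟨y, ⟨⟨_, hy⟩, _⟩, hxy⟩
    obtain rfl : x = l := by lia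
    exact hl hPx
  rw [hsplit, Finset.card_union_of_disjoint hdisj,
    Finset.card_image_of_injective _ fun x y hxy => by simpa using hxy, two_mul]

theorem two_mul_lcm_dvd_iff {ι : Type*} [Fintype ι] [Nonempty ι] (a : ι → ℤ) (y : ℤ) :
    2 * Finset.univ.lcm a ∣ y ↔ ∀ i, 2 * a i ∣ y := by
  refine ⟨fun h i => (mul_dvd_mul_left 2 (Finset.dvd_lcm (Finset.mem_univ i))).trans h, fun h => ?_⟩
  obtain ⟨z, rfl⟩ := (dvd_mul_right 2 _).trans (h (Classical.arbitrary ι))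
  exact mul_dvd_mul_left 2 (Finset.lcm_dvd fun i _ => (mul_dvd_mul_iff_left two_ne_zero).1 (h i))

theorem Int.eq_zero_or_eq_of_dvd {a w : ℤ} (hw : 0 ≤ w ∧ w ≤ a) (h : a ∣ w) : w = 0 ∨ w = a := by
  rcases hw.1.eq_or_lt with h₀ | h₀
  · exact Or.inl h₀.symm
  · exact Or.inr (le_antisymm hw.2 (Int.le_of_dvd h₀ h))

/-- For a non-corner point `v`, with `J(v) = {i : 2 a i ∣ 2 v i}` and `A(v)` the set of
assignments `g : [n] → {0,1}` such that `gcd (2 a i) (2 a j)` divides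
`(-1)^(g i) * v i - (-1)^(g j) * v j` for all `i ≠ j`, we have
`2 ^ (|J(v)| + 1) * M(v) = |A(v)|`. -/
theorem crossingNumber_eq_card_CSP (n : ℕ) (hn : 1 ≤ n)
    (a : Fin n → ℤ) (ha : ∀ i, 0 < a i)
    (v : Fin n → ℤ) (hv : ∀ i, 0 ≤ v i ∧ v i ≤ a i)
    (hnotcorner : ¬ ∀ i, v i = 0 ∨ v i = a i) :
    2 ^ ((Finset.univ.filter (fun i => 2 * a i ∣ 2 * v i)).card + 1) *
      crossingNumber n a v =
    Nat.card {g : Fin n → Fin 2 // ∀ i j, i ≠ j →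
      (Int.gcd (2 * a i) (2 * a j) : ℤ) ∣
        (-1) ^ (g i : ℕ) * v i - (-1) ^ (g j : ℕ) * v j} := by
  have : Nonempty (Fin n) := ⟨⟨0, hn⟩⟩
  set l := Finset.univ.lcm a with hl
  have hl_pos : 0 < l := by
    refine lt_of_le_of_ne (Int.nonneg_of_normalize_eq_self Finset.normalize_lcm) (Ne.symm ?_)
    rw [hl, Ne, Finset.lcm_eq_zero_iff]
    rintro ⟨i, -, hi⟩
    exact (ha i).ne' hi
  have ha_dvd : ∀ i, a i ∣ l := fun i => Finset.dvd_lcm (Finset.mem_univ i)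
  let P : ℤ → Prop := fun x => ∀ i, 2 * a i ∣ x - v i ∨ 2 * a i ∣ x + v i
  -- A multiple of every `a i` is crossed only at a corner.
  have hP_corner : ∀ x, (∀ i, a i ∣ x) → ¬ P x := fun x hx hPx => hnotcorner fun i => by
    refine Int.eq_zero_or_eq_of_dvd (hv i) ?_
    rcases hPx i with h | h
    · exact (dvd_sub_right (hx i)).1 ((dvd_mul_left _ _).trans h)
    · exact (dvd_add_right (hx i)).1 ((dvd_mul_left _ _).trans h)
  have hP_reflect : ∀ x, P (2 * l - x) ↔ P x := fun x => forall_congr' fun i => by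
    have h2 : 2 * a i ∣ 2 * l := mul_dvd_mul_left 2 (ha_dvd i)
    rw [sub_sub, dvd_sub_right h2, sub_add, dvd_sub_right h2, or_comm]
  have hM : crossingNumber n a v = ((Finset.Icc 0 l).filter P).card :=
    Nat.subtype_card _ fun x => by simp [P, hl, and_assoc]
  classical
  set A := Finset.univ.filter fun g : Fin n → Fin 2 => ∀ i j, i ≠ j →
    (Int.gcd (2 * a i) (2 * a j) : ℤ) ∣ (-1) ^ (g i : ℕ) * v i - (-1) ^ (g j : ℕ) * v j with hA
  have hA_card := Nat.subtype_card (p := fun g => ∀ i j, i ≠ j →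
    (Int.gcd (2 * a i) (2 * a j) : ℤ) ∣ (-1) ^ (g i : ℕ) * v i - (-1) ^ (g j : ℕ) * v j) A
    fun g => by simp [hA]
  have hcount := Finset.sum_card_bipartiteAbove_eq_sum_card_bipartiteBelow
    (s := (Finset.Ico 0 (2 * l)).filter P) (t := A)
    (fun x g => ∀ i, 2 * a i ∣ x - (-1) ^ (g i : ℕ) * v i)
  have habove : ∀ x ∈ (Finset.Ico 0 (2 * l)).filter P,
      (A.bipartiteAbove (fun x g => ∀ i, 2 * a i ∣ x - (-1) ^ (g i : ℕ) * v i) x).card =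
        2 ^ (Finset.univ.filter fun i => 2 * a i ∣ 2 * v i).card := fun x hx => by
    rw [← card_filter_forall_dvd_sub_sign_mul (Finset.mem_filter.1 hx).2]
    congr 1
    ext g
    simp only [Finset.mem_bipartiteAbove, hA, Finset.mem_filter, Finset.mem_univ, true_and,
      and_iff_right_iff_imp]
    intro hg i j _
    simpa using dvd_sub ((Int.gcd_dvd_right (2 * a i) (2 * a j)).trans (hg j))
      ((Int.gcd_dvd_left (2 * a i) (2 * a j)).trans (hg i))
  have hbelow : ∀ g ∈ A, (((Finset.Ico 0 (2 * l)).filter P).bipartiteBelow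
      (fun x g => ∀ i, 2 * a i ∣ x - (-1) ^ (g i : ℕ) * v i) g).card = 1 := fun g hg => by
    rw [← card_filter_Ico_forall_dvd_sub (m := fun i => 2 * a i)
      (c := fun i => (-1) ^ (g i : ℕ) * v i) (L := 2 * l) (by lia) (two_mul_lcm_dvd_iff a)
      fun i j hij => by simpa only [Int.coe_gcd] using (Finset.mem_filter.1 hg).2 i j hij]
    congr 1
    ext x
    simp only [Finset.mem_bipartiteBelow, Finset.mem_filter, and_assoc]
    refine and_congr_right fun _ => and_iff_right_of_imp fun hx i => ?_
    have hxi := hx i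
    generalize g i = b at hxi
    fin_cases b
    · exact Or.inl (by simpa using hxi)
    · exact Or.inr (by simpa using hxi)
  rw [Finset.sum_congr rfl habove, Finset.sum_congr rfl hbelow, Finset.sum_const,
    Finset.sum_const, smul_eq_mul, smul_eq_mul, mul_one,
    card_filter_Ico_two_mul (hP_corner 0 fun i => dvd_zero _) (hP_corner l ha_dvd) hP_reflect]
    at hcount
  rw [hA_card, ← hcount, hM, pow_succ]
  ring
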